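/- For smooth ψ, η : D̄ → ℝ, the quantity ∫_D [4(ψ_x + η_y)² + 4(η_x − ψ_y)²] dx dy is nonnegative, and combined with the nonnegativity of ∫_D [(rφ_r − σ_θ)² + (rσ_r + φ_θ)²] dr dθ, the second derivative at t = 0 of the ∂̄-energy of the family F_t (deforming f₄(x,y) = (x, −y, 0, 0) in the weakly pseudoconvex domain M = {(x₁−y₂)² + (x₂+y₁)² < 1} with variation field V = (σ/2)(x,−y,−y,−x) + (φ/2)(y,x,x,−y) + ψ(1,0,0,1) + η(0,1,−1,0), σ = 0 on ∂D) is nonnegative: d²/dt²|_{t=0} ∫_D |∂F_t/∂x + J ∂F_t/∂y|² = ∫_D (rφ_r − σ_θ)² + (rσ_r + φ_θ)² dr dθ + ∫_D 4(ψ_x+η_y)² + 4(η_x−ψ_y)² dx dy ≥ 0. -/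

import Mathlib

open MeasureTheory Complex intervalIntegral

noncomputable def pol (r θ : ℝ) : ℂ := (r : ℂ) * Complex.exp (θ * Complex.I)

noncomputable def pdr (σ : ℂ → ℝ) (r θ : ℝ) : ℝ := deriv (fun s : ℝ => σ (pol s θ)) r

noncomputable def pdθ (σ : ℂ → ℝ) (r θ : ℝ) : ℝ := deriv (fun t : ℝ => σ (pol r t)) θ

/-- The explicit family F_t deforming f₄(x,y) = (x, −y, 0, 0), written in the complex
coordinates z_j = x_j + i y_j of ℝ⁴ = (x₁,x₂,y₁,y₂) ≅ ℂ²: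
F_t(r,θ) = ( [(1+tσ) r cos(θ−tφ) + r cos θ]/2 + tψ, [−(1+tσ) r sin(θ−tφ) − r sin θ]/2 + tη,
[−(1+tσ) r sin(θ−tφ) + r sin θ]/2 − tη, [−(1+tσ) r cos(θ−tφ) + r cos θ]/2 + tψ ). -/
noncomputable def Ffam (σ φ ψ η : ℂ → ℝ) (t : ℝ) (z : ℂ) : ℂ × ℂ :=
  let x := z.re; let y := z.im
  let a := (1 + t * σ z) * (x * Real.cos (t * φ z) + y * Real.sin (t * φ z))
  let b := (1 + t * σ z) * (y * Real.cos (t * φ z) - x * Real.sin (t * φ z))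
  ((((a + x) / 2 + t * ψ z : ℝ) : ℂ) + Complex.I * (((-b + y) / 2 - t * η z : ℝ) : ℂ),
   (((-b - y) / 2 + t * η z : ℝ) : ℂ) + Complex.I * (((-a + x) / 2 + t * ψ z : ℝ) : ℂ))

/-- squared Hermitian norm on ℂ². -/
noncomputable def nsq (w : ℂ × ℂ) : ℝ := ‖w.1‖^2 + ‖w.2‖^2

/-- the ∂̄-energy (up to the factor 4) of F_t : ∫_D |∂F_t/∂x + J ∂F_t/∂y|². -/
noncomputable def Gfam (σ φ ψ η : ℂ → ℝ) (t : ℝ) : ℝ :=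
  ∫ z in Metric.ball (0:ℂ) 1,
    nsq (fderiv ℝ (Ffam σ φ ψ η t) z 1 + Complex.I • fderiv ℝ (Ffam σ φ ψ η t) z Complex.I)


/-- The radial derivative `r ∂f/∂r`. -/
noncomputable def radDeriv (f : ℂ → ℝ) (z : ℂ) : ℝ := fderiv ℝ f z z

/-- The angular derivative `∂f/∂θ`. -/
noncomputable def angDeriv (f : ℂ → ℝ) (z : ℂ) : ℝ := fderiv ℝ f z (I * z)

lemma continuous_pol : Continuous (fun p : ℝ × ℝ => pol p.1 p.2) := by
  unfold pol; fun_prop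

lemma hasDerivAt_pol_left (r θ : ℝ) :
    HasDerivAt (fun s : ℝ => pol s θ) (exp (θ * I)) r := by
  simpa [pol] using (ofRealCLM.hasDerivAt (x := r)).mul_const (exp (θ * I))

lemma hasDerivAt_pol_right (r θ : ℝ) :
    HasDerivAt (fun t : ℝ => pol r t) (I * pol r θ) θ := by
  have h : HasDerivAt (fun t : ℝ => (t : ℂ) * I) I θ := by
    simpa using (ofRealCLM.hasDerivAt (x := θ)).mul_const I
  refine (h.cexp.const_mul (r : ℂ)).congr_deriv ?_
  simp only [pol]; ring

lemma hasDerivAt_comp_pol_left {f : ℂ → ℝ} (hf : Differentiable ℝ f) (r θ : ℝ) :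
    HasDerivAt (fun s : ℝ => f (pol s θ)) (fderiv ℝ f (pol r θ) (exp (θ * I))) r :=
  (hf (pol r θ)).hasFDerivAt.comp_hasDerivAt r (hasDerivAt_pol_left r θ)

lemma hasDerivAt_comp_pol_right {f : ℂ → ℝ} (hf : Differentiable ℝ f) (r θ : ℝ) :
    HasDerivAt (fun t : ℝ => f (pol r t)) (angDeriv f (pol r θ)) θ :=
  (hf (pol r θ)).hasFDerivAt.comp_hasDerivAt θ (hasDerivAt_pol_right r θ)

lemma mul_fderiv_exp (f : ℂ → ℝ) (r θ : ℝ) :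
    r * fderiv ℝ f (pol r θ) (exp (θ * I)) = radDeriv f (pol r θ) := by
  rw [radDeriv, ← smul_eq_mul, ← map_smul]
  simp [pol]

lemma mul_pdr {f : ℂ → ℝ} (hf : Differentiable ℝ f) (r θ : ℝ) :
    r * pdr f r θ = radDeriv f (pol r θ) := by
  rw [pdr, (hasDerivAt_comp_pol_left hf r θ).deriv, mul_fderiv_exp]

lemma pdθ_eq {f : ℂ → ℝ} (hf : Differentiable ℝ f) (r θ : ℝ) :
    pdθ f r θ = angDeriv f (pol r θ) :=
  (hasDerivAt_comp_pol_right hf r θ).deriv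

lemma contDiff_radDeriv {f : ℂ → ℝ} (hf : ContDiff ℝ (⊤ : ℕ∞) f) :
    ContDiff ℝ (⊤ : ℕ∞) (radDeriv f) :=
  (hf.fderiv_right (m := (⊤ : ℕ∞)) (by simp)).clm_apply contDiff_id

lemma contDiff_angDeriv {f : ℂ → ℝ} (hf : ContDiff ℝ (⊤ : ℕ∞) f) :
    ContDiff ℝ (⊤ : ℕ∞) (angDeriv f) :=
  (hf.fderiv_right (m := (⊤ : ℕ∞)) (by simp)).clm_apply (contDiff_const.mul contDiff_id)

lemma radDeriv_mul {f g : ℂ → ℝ} (hf : Differentiable ℝ f) (hg : Differentiable ℝ g) (z : ℂ) :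
    radDeriv (fun w => f w * g w) z = radDeriv f z * g z + f z * radDeriv g z := by
  simp only [radDeriv]
  rw [fderiv_fun_mul (hf z) (hg z)]
  simp; ring

lemma angDeriv_mul {f g : ℂ → ℝ} (hf : Differentiable ℝ f) (hg : Differentiable ℝ g) (z : ℂ) :
    angDeriv (fun w => f w * g w) z = angDeriv f z * g z + f z * angDeriv g z := by
  simp only [angDeriv]
  rw [fderiv_fun_mul (hf z) (hg z)]
  simp; ring

lemma radDeriv_angDeriv_comm {f : ℂ → ℝ} (hf : ContDiff ℝ (⊤ : ℕ∞) f) (z : ℂ) :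
    radDeriv (angDeriv f) z = angDeriv (radDeriv f) z := by
  have hd : DifferentiableAt ℝ (fderiv ℝ f) z :=
    (hf.fderiv_right (m := (⊤ : ℕ∞)) (by simp)).differentiable (by simp) z
  have hsymm : IsSymmSndFDerivAt ℝ f z :=
    hf.contDiffAt.isSymmSndFDerivAt (by simp; exact WithTop.coe_le_coe.2 le_top)
  have hr : HasFDerivAt (radDeriv f) _ z := hd.hasFDerivAt.clm_apply (hasFDerivAt_id z)
  have ha : HasFDerivAt (angDeriv f) _ z :=
    hd.hasFDerivAt.clm_apply ((hasFDerivAt_id z).const_mul I)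
  rw [radDeriv, angDeriv, hr.fderiv, ha.fderiv]
  have := hsymm.eq z (I * z)
  simp [this]

lemma pol_periodic (r : ℝ) : Function.Periodic (pol r) (2 * Real.pi) := by
  intro θ
  have : ((θ + 2 * Real.pi : ℝ) : ℂ) * I = θ * I + 2 * Real.pi * I := by push_cast; ring
  simp only [pol, this, Complex.exp_periodic _]

lemma integral_ball_eq_integral_pol {f : ℂ → ℝ} (hf : Continuous f) :
    ∫ z in Metric.ball (0:ℂ) 1, f z =
      ∫ r in (0:ℝ)..1, ∫ θ in (0:ℝ)..(2 * Real.pi), r * f (pol r θ) := by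
  have hcont : Continuous (fun p : ℝ × ℝ => p.1 * f (pol p.1 p.2)) :=
    continuous_fst.mul (hf.comp continuous_pol)
  have hint : IntegrableOn (fun p : ℝ × ℝ => p.1 * f (pol p.1 p.2))
      (Set.Ioo 0 1 ×ˢ Set.Ioo (-Real.pi) Real.pi) (volume.prod volume) :=
    ((hcont.continuousOn).integrableOn_compact (isCompact_Icc.prod isCompact_Icc)).mono_set
      (Set.prod_mono Set.Ioo_subset_Icc_self Set.Ioo_subset_Icc_self)
  rw [← MeasureTheory.integral_indicator measurableSet_ball, ← Complex.integral_comp_polarCoord_symm]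
  have hsub : Set.Ioo (0:ℝ) 1 ×ˢ Set.Ioo (-Real.pi) Real.pi ⊆ _root_.polarCoord.target := by
    rintro ⟨r, θ⟩ ⟨hr, hθ⟩
    exact ⟨hr.1, hθ⟩
  have hsymm : ∀ p : ℝ × ℝ, Complex.polarCoord.symm p = pol p.1 p.2 := by
    intro p
    rw [Complex.polarCoord_symm_apply, pol, Complex.exp_mul_I]
    simp
  have hstep : ∫ p in _root_.polarCoord.target,
      p.1 • (Metric.ball (0:ℂ) 1).indicator f (Complex.polarCoord.symm p) =
      ∫ p in Set.Ioo (0:ℝ) 1 ×ˢ Set.Ioo (-Real.pi) Real.pi, p.1 * f (pol p.1 p.2) := by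
    rw [setIntegral_eq_of_subset_of_forall_sdiff_eq_zero
      (_root_.polarCoord.open_target.measurableSet) hsub]
    · refine setIntegral_congr_fun (measurableSet_Ioo.prod measurableSet_Ioo) ?_
      rintro ⟨r, θ⟩ ⟨hr, hθ⟩
      have hmem : pol r θ ∈ Metric.ball (0:ℂ) 1 := by
        simpa [pol, Complex.norm_exp_ofReal_mul_I, abs_of_pos hr.1] using hr.2
      simp only [hsymm, Set.indicator_of_mem hmem, smul_eq_mul]
    · rintro ⟨r, θ⟩ ⟨h1, h2⟩
      have hr : 0 < r := h1.1
      have hmem : pol r θ ∉ Metric.ball (0:ℂ) 1 := by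
        intro hm
        apply h2
        refine ⟨⟨hr, ?_⟩, h1.2⟩
        simpa [pol, Complex.norm_exp_ofReal_mul_I, abs_of_pos hr] using hm
      simp only [hsymm, Set.indicator_of_notMem hmem, smul_zero]
  rw [hstep, Measure.volume_eq_prod, setIntegral_prod _ hint, ← integral_Ioc_eq_integral_Ioo,
    ← intervalIntegral.integral_of_le zero_le_one]
  refine intervalIntegral.integral_congr fun r _ => ?_
  simp only
  rw [← integral_Ioc_eq_integral_Ioo,
    ← intervalIntegral.integral_of_le (by linarith [Real.pi_pos])]
  have hper : Function.Periodic (fun θ => r * f (pol r θ)) (2 * Real.pi) := fun θ => by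
    simp only [pol_periodic r θ]
  have := hper.intervalIntegral_add_eq (-Real.pi) 0
  rw [zero_add] at this
  rw [← this]
  congr 1; ring

lemma integral_ball_eq_integral_pol' {f : ℂ → ℝ} (hf : Continuous f) :
    ∫ z in Metric.ball (0:ℂ) 1, f z =
      ∫ θ in (0:ℝ)..(2 * Real.pi), ∫ r in (0:ℝ)..1, r * f (pol r θ) := by
  rw [integral_ball_eq_integral_pol hf]
  have hcont : Continuous (fun p : ℝ × ℝ => p.1 * f (pol p.1 p.2)) :=
    continuous_fst.mul (hf.comp continuous_pol)
  refine intervalIntegral_intervalIntegral_swap ?_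
  exact ((hcont.continuousOn).integrableOn_compact (isCompact_uIcc.prod isCompact_uIcc)).mono_set
    (Set.prod_mono Set.uIoc_subset_uIcc Set.uIoc_subset_uIcc)

lemma integral_ball_angDeriv {f : ℂ → ℝ} (hf : ContDiff ℝ (⊤ : ℕ∞) f) :
    ∫ z in Metric.ball (0:ℂ) 1, angDeriv f z = 0 := by
  have hc : Continuous (angDeriv f) := (contDiff_angDeriv hf).continuous
  rw [integral_ball_eq_integral_pol hc]
  have : ∀ r : ℝ, ∫ θ in (0:ℝ)..(2 * Real.pi), r * angDeriv f (pol r θ) = 0 := by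
    intro r
    rw [intervalIntegral.integral_const_mul, integral_eq_sub_of_hasDerivAt
      (fun θ _ => hasDerivAt_comp_pol_right (hf.differentiable (by simp)) r θ)]
    · have := pol_periodic r 0
      rw [zero_add] at this
      simp [this]
    · exact (hc.comp (continuous_pol.comp (by fun_prop : Continuous fun θ : ℝ => (r, θ)))
        ).intervalIntegrable _ _
  simp [this]

lemma integral_ball_radial {f : ℂ → ℝ} (hf : ContDiff ℝ (⊤ : ℕ∞) f)
    (h0 : ∀ z ∈ Metric.sphere (0:ℂ) 1, f z = 0) :
    ∫ z in Metric.ball (0:ℂ) 1, (2 * f z + radDeriv f z) = 0 := by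
  have hc : Continuous fun z => 2 * f z + radDeriv f z :=
    (continuous_const.mul hf.continuous).add (contDiff_radDeriv hf).continuous
  rw [integral_ball_eq_integral_pol' hc]
  have : ∀ θ : ℝ, ∫ r in (0:ℝ)..1, r * (2 * f (pol r θ) + radDeriv f (pol r θ)) = 0 := by
    intro θ
    have hd : ∀ r ∈ Set.uIcc (0:ℝ) 1, HasDerivAt (fun s : ℝ => s ^ 2 * f (pol s θ))
        (r * (2 * f (pol r θ) + radDeriv f (pol r θ))) r := by
      intro r _
      refine (((hasDerivAt_id r).pow 2).mul
        (hasDerivAt_comp_pol_left (hf.differentiable (by simp)) r θ)).congr_deriv ?_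
      rw [← mul_fderiv_exp]
      simp; ring
    rw [integral_eq_sub_of_hasDerivAt hd]
    · have : f (pol 1 θ) = 0 := h0 _ (by simp [pol, Complex.norm_exp_ofReal_mul_I])
      simp [this]
    · exact (continuous_id.mul (hc.comp (continuous_pol.comp
        (by fun_prop : Continuous fun r : ℝ => (r, θ))))).intervalIntegrable _ _
  simp [this]

lemma fderiv_apply_eq (f : ℂ → ℝ) (z w : ℂ) :
    fderiv ℝ f z w = w.re * fderiv ℝ f z 1 + w.im * fderiv ℝ f z I := by
  conv_lhs => rw [show w = w.re • (1:ℂ) + w.im • I by apply Complex.ext <;> simp]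
  rw [map_add, map_smul, map_smul, smul_eq_mul, smul_eq_mul]

lemma nsq_fderiv_of_components {f g h k : ℂ → ℝ}
    {f' g' h' k' : ℂ →L[ℝ] ℝ} {F : ℂ → ℂ × ℂ} {z : ℂ}
    (hF : ∀ w, F w = ((f w : ℂ) + I * (g w : ℂ), (h w : ℂ) + I * (k w : ℂ)))
    (hf : HasFDerivAt f f' z) (hg : HasFDerivAt g g' z) (hh : HasFDerivAt h h' z)
    (hk : HasFDerivAt k k' z) :
    nsq (fderiv ℝ F z 1 + I • fderiv ℝ F z I) =
      (f' 1 - g' I) ^ 2 + (g' 1 + f' I) ^ 2 + (h' 1 - k' I) ^ 2 + (k' 1 + h' I) ^ 2 := by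
  have hd := ((ofRealCLM.hasFDerivAt.comp z hf).add
    ((ofRealCLM.hasFDerivAt.comp z hg).const_mul I)).prodMk
    ((ofRealCLM.hasFDerivAt.comp z hh).add ((ofRealCLM.hasFDerivAt.comp z hk).const_mul I))
  rw [(hd.congr_of_eventuallyEq (f₁ := F) (Filter.Eventually.of_forall hF)).fderiv]
  simp only [nsq, ← Complex.normSq_eq_norm_sq, Complex.normSq_apply]
  simp
  ring

lemma nsq_fderiv_half_sum {a b ψ η : ℂ → ℝ} {a' b' : ℂ →L[ℝ] ℝ} {F : ℂ → ℂ × ℂ} {t : ℝ} {z : ℂ}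
    (hF : ∀ w, F w =
      ((((a w + w.re) / 2 + t * ψ w : ℝ) : ℂ) + I * (((-b w + w.im) / 2 - t * η w : ℝ) : ℂ),
       (((-b w - w.im) / 2 + t * η w : ℝ) : ℂ) + I * (((-a w + w.re) / 2 + t * ψ w : ℝ) : ℂ)))
    (ha : HasFDerivAt a a' z) (hb : HasFDerivAt b b' z)
    (hψ : DifferentiableAt ℝ ψ z) (hη : DifferentiableAt ℝ η z) :
    nsq (fderiv ℝ F z 1 + I • fderiv ℝ F z I) =
      ((a' 1 + b' I) ^ 2 + (a' I - b' 1) ^ 2) / 2 +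
      2 * t ^ 2 * ((fderiv ℝ ψ z 1 + fderiv ℝ η z I) ^ 2 +
        (fderiv ℝ η z 1 - fderiv ℝ ψ z I) ^ 2) := by
  have hx : HasFDerivAt (fun w : ℂ => w.re) reCLM z := reCLM.hasFDerivAt
  have hy : HasFDerivAt (fun w : ℂ => w.im) imCLM z := imCLM.hasFDerivAt
  have hp := hψ.hasFDerivAt.const_mul t
  have hn := hη.hasFDerivAt.const_mul t
  have half : ∀ {f : ℂ → ℝ} {f' : ℂ →L[ℝ] ℝ}, HasFDerivAt f f' z →
      HasFDerivAt (fun w => f w / 2) ((2⁻¹ : ℝ) • f') z := fun hf => by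
    simpa only [div_eq_mul_inv] using hf.mul_const (2⁻¹ : ℝ)
  rw [nsq_fderiv_of_components hF ((half (ha.fun_add hx)).fun_add hp)
    ((half (hb.fun_neg.fun_add hy)).fun_sub hn) ((half (hb.fun_neg.fun_sub hy)).fun_add hn)
    ((half (ha.fun_neg.fun_add hx)).fun_add hp)]
  simp
  ring

lemma nsq_fderiv_Ffam {σ φ ψ η : ℂ → ℝ} (hσ : Differentiable ℝ σ) (hφ : Differentiable ℝ φ)
    (hψ : Differentiable ℝ ψ) (hη : Differentiable ℝ η) (t : ℝ) (z : ℂ) :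
    nsq (fderiv ℝ (Ffam σ φ ψ η t) z 1 + I • fderiv ℝ (Ffam σ φ ψ η t) z I) =
      ((2 * (1 + t * σ z) + t * radDeriv σ z - t * (1 + t * σ z) * angDeriv φ z) ^ 2 +
        (t * angDeriv σ z + t * (1 + t * σ z) * radDeriv φ z) ^ 2) / 2 +
      2 * t ^ 2 * ((fderiv ℝ ψ z 1 + fderiv ℝ η z I) ^ 2 +
        (fderiv ℝ η z 1 - fderiv ℝ ψ z I) ^ 2) := by
  have hx : HasFDerivAt (fun w : ℂ => w.re) reCLM z := reCLM.hasFDerivAt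
  have hy : HasFDerivAt (fun w : ℂ => w.im) imCLM z := imCLM.hasFDerivAt
  have hρ := ((hσ z).hasFDerivAt.const_mul t).const_add 1
  have hcos := ((hφ z).hasFDerivAt.const_mul t).cos
  have hsin := ((hφ z).hasFDerivAt.const_mul t).sin
  have ha := hρ.fun_mul ((hx.fun_mul hcos).fun_add (hy.fun_mul hsin))
  have hb := hρ.fun_mul ((hy.fun_mul hcos).fun_sub (hx.fun_mul hsin))
  rw [nsq_fderiv_half_sum (F := Ffam σ φ ψ η t) (t := t) (fun w => rfl) ha hb (hψ z) (hη z)]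
  have hcs := Real.cos_sq_add_sin_sq (t * φ z)
  have key := fun U Q : ℝ => show (Real.cos (t * φ z) * U - Real.sin (t * φ z) * Q) ^ 2 +
      (Real.sin (t * φ z) * U + Real.cos (t * φ z) * Q) ^ 2 = U ^ 2 + Q ^ 2 by
    linear_combination (U ^ 2 + Q ^ 2) * hcs
  rw [← key (2 * (1 + t * σ z) + t * radDeriv σ z - t * (1 + t * σ z) * angDeriv φ z)
    (t * angDeriv σ z + t * (1 + t * σ z) * radDeriv φ z)]
  simp only [radDeriv, angDeriv, fderiv_apply_eq _ z z, fderiv_apply_eq _ z (I * z)]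
  generalize Real.cos (t * φ z) = c
  generalize Real.sin (t * φ z) = s
  simp
  ring

/-- The coefficient of `t ^ 2` in the integrand of the energy. -/
noncomputable def secondOrder (σ φ ψ η : ℂ → ℝ) (z : ℂ) : ℝ :=
  ((2 * σ z + radDeriv σ z - angDeriv φ z) ^ 2 - 4 * (σ z * angDeriv φ z) +
    (angDeriv σ z + radDeriv φ z) ^ 2) / 2 +
  2 * ((fderiv ℝ ψ z 1 + fderiv ℝ η z I) ^ 2 + (fderiv ℝ η z 1 - fderiv ℝ ψ z I) ^ 2)

lemma integrableOn_ball {f : ℂ → ℝ} (hf : Continuous f) :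
    IntegrableOn f (Metric.ball (0:ℂ) 1) :=
  (hf.continuousOn.integrableOn_compact (isCompact_closedBall 0 1)).mono_set
    Metric.ball_subset_closedBall

lemma continuous_fderiv_apply {f : ℂ → ℝ} (hf : ContDiff ℝ (⊤ : ℕ∞) f) (w : ℂ) :
    Continuous fun z => fderiv ℝ f z w :=
  (hf.continuous_fderiv (by simp)).clm_apply continuous_const

lemma deriv_deriv_quartic (c₀ c₁ c₂ c₃ c₄ : ℝ) :
    deriv (deriv fun t : ℝ => c₀ + t * c₁ + t ^ 2 * c₂ + t ^ 3 * c₃ + t ^ 4 * c₄) 0 =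
      2 * c₂ := by
  have h1 : deriv (fun t : ℝ => c₀ + t * c₁ + t ^ 2 * c₂ + t ^ 3 * c₃ + t ^ 4 * c₄) =
      fun t => c₁ + 2 * c₂ * t + 3 * c₃ * t ^ 2 + 4 * c₄ * t ^ 3 := by
    funext t
    refine HasDerivAt.deriv ?_
    refine ((((((hasDerivAt_id t).mul_const c₁).const_add c₀).add
      ((hasDerivAt_pow 2 t).mul_const c₂)).add ((hasDerivAt_pow 3 t).mul_const c₃)).add
      ((hasDerivAt_pow 4 t).mul_const c₄)).congr_deriv ?_
    norm_num; ring
  rw [h1]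
  refine HasDerivAt.deriv ?_
  refine (((((hasDerivAt_id (0:ℝ)).const_mul (2 * c₂)).const_add c₁).add
    ((hasDerivAt_pow 2 (0:ℝ)).const_mul (3 * c₃))).add
    ((hasDerivAt_pow 3 (0:ℝ)).const_mul (4 * c₄))).congr_deriv ?_
  norm_num

lemma deriv_deriv_Gfam {σ φ ψ η : ℂ → ℝ} (hσ : ContDiff ℝ (⊤ : ℕ∞) σ)
    (hφ : ContDiff ℝ (⊤ : ℕ∞) φ) (hψ : ContDiff ℝ (⊤ : ℕ∞) ψ) (hη : ContDiff ℝ (⊤ : ℕ∞) η) :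
    deriv (deriv (Gfam σ φ ψ η)) 0 =
      2 * ∫ z in Metric.ball (0:ℂ) 1, secondOrder σ φ ψ η z := by
  have c1 := hσ.continuous
  have c2 := (contDiff_radDeriv hσ).continuous
  have c3 := (contDiff_angDeriv hσ).continuous
  have c4 := (contDiff_radDeriv hφ).continuous
  have c5 := (contDiff_angDeriv hφ).continuous
  have c6 := continuous_fderiv_apply hψ 1
  have c7 := continuous_fderiv_apply hψ I
  have c8 := continuous_fderiv_apply hη 1
  have c9 := continuous_fderiv_apply hη I
  let u : ℂ → ℝ := fun z => 2 * σ z + radDeriv σ z - angDeriv φ z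
  let v : ℂ → ℝ := fun z => σ z * angDeriv φ z
  let p : ℂ → ℝ := fun z => angDeriv σ z + radDeriv φ z
  let q : ℂ → ℝ := fun z => σ z * radDeriv φ z
  have i0 : IntegrableOn (fun _ : ℂ => (2:ℝ)) (Metric.ball (0:ℂ) 1) :=
    integrableOn_ball (by fun_prop)
  have i1 : IntegrableOn (fun z => 2 * u z) (Metric.ball (0:ℂ) 1) :=
    integrableOn_ball (by fun_prop)
  have i2 : IntegrableOn (secondOrder σ φ ψ η) (Metric.ball (0:ℂ) 1) :=
    integrableOn_ball (by unfold secondOrder; fun_prop)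
  have i3 : IntegrableOn (fun z => p z * q z - u z * v z) (Metric.ball (0:ℂ) 1) :=
    integrableOn_ball (by fun_prop)
  have i4 : IntegrableOn (fun z => (v z ^ 2 + q z ^ 2) / 2) (Metric.ball (0:ℂ) 1) :=
    integrableOn_ball (by fun_prop)
  have hG : Gfam σ φ ψ η = fun t =>
      (∫ _ in Metric.ball (0:ℂ) 1, (2:ℝ)) + t * (∫ z in Metric.ball (0:ℂ) 1, 2 * u z) +
      t ^ 2 * (∫ z in Metric.ball (0:ℂ) 1, secondOrder σ φ ψ η z) +
      t ^ 3 * (∫ z in Metric.ball (0:ℂ) 1, (p z * q z - u z * v z)) +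
      t ^ 4 * (∫ z in Metric.ball (0:ℂ) 1, (v z ^ 2 + q z ^ 2) / 2) := by
    funext t
    simp only [← MeasureTheory.integral_const_mul]
    have j1 := Integrable.fun_add i0 (i1.const_mul t)
    have j2 := Integrable.fun_add j1 (i2.const_mul (t ^ 2))
    have j3 := Integrable.fun_add j2 (i3.const_mul (t ^ 3))
    rw [← MeasureTheory.integral_add i0 (i1.const_mul t),
      ← MeasureTheory.integral_add j1 (i2.const_mul (t ^ 2)),
      ← MeasureTheory.integral_add j2 (i3.const_mul (t ^ 3)),
      ← MeasureTheory.integral_add j3 (i4.const_mul (t ^ 4))]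
    refine setIntegral_congr_fun measurableSet_ball fun z _ => ?_
    simp only [nsq_fderiv_Ffam (hσ.differentiable (by simp)) (hφ.differentiable (by simp))
      (hψ.differentiable (by simp)) (hη.differentiable (by simp)), secondOrder, u, v, p, q]
    ring
  rw [hG, deriv_deriv_quartic]

lemma two_mul_integral_secondOrder {σ φ ψ η : ℂ → ℝ} (hσ : ContDiff ℝ (⊤ : ℕ∞) σ)
    (hφ : ContDiff ℝ (⊤ : ℕ∞) φ) (hψ : ContDiff ℝ (⊤ : ℕ∞) ψ) (hη : ContDiff ℝ (⊤ : ℕ∞) η)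
    (hσ0 : ∀ z ∈ Metric.sphere (0:ℂ) 1, σ z = 0) :
    2 * ∫ z in Metric.ball (0:ℂ) 1, secondOrder σ φ ψ η z =
      (∫ z in Metric.ball (0:ℂ) 1,
        ((radDeriv φ z - angDeriv σ z) ^ 2 + (radDeriv σ z + angDeriv φ z) ^ 2)) +
      ∫ z in Metric.ball (0:ℂ) 1, (4 * (fderiv ℝ ψ z 1 + fderiv ℝ η z I) ^ 2 +
        4 * (fderiv ℝ η z 1 - fderiv ℝ ψ z I) ^ 2) := by
  have sr := contDiff_radDeriv hσ
  have sa := contDiff_angDeriv hσ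
  have pr := contDiff_radDeriv hφ
  have pa := contDiff_angDeriv hφ
  have c1 := hσ.continuous
  have c2 := sr.continuous
  have c3 := sa.continuous
  have c4 := pr.continuous
  have c5 := pa.continuous
  have c6 := continuous_fderiv_apply hψ 1
  have c7 := continuous_fderiv_apply hψ I
  have c8 := continuous_fderiv_apply hη 1
  have c9 := continuous_fderiv_apply hη I
  have hg : ContDiff ℝ (⊤ : ℕ∞) fun z => σ z * (2 * σ z - 4 * angDeriv φ z) :=
    hσ.mul ((contDiff_const.mul hσ).sub (contDiff_const.mul pa))
  have hh : ContDiff ℝ (⊤ : ℕ∞) fun z => σ z * (4 * radDeriv φ z) :=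
    hσ.mul (contDiff_const.mul pr)
  have hrad := integral_ball_radial hg (fun z hz => by simp [hσ0 z hz])
  have hang := integral_ball_angDeriv hh
  have i1 : IntegrableOn (fun z =>
      (radDeriv φ z - angDeriv σ z) ^ 2 + (radDeriv σ z + angDeriv φ z) ^ 2)
      (Metric.ball (0:ℂ) 1) := integrableOn_ball (by fun_prop)
  have i2 : IntegrableOn (fun z => 4 * (fderiv ℝ ψ z 1 + fderiv ℝ η z I) ^ 2 +
      4 * (fderiv ℝ η z 1 - fderiv ℝ ψ z I) ^ 2) (Metric.ball (0:ℂ) 1) :=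
    integrableOn_ball (by fun_prop)
  have cg : Continuous fun z => 2 * (σ z * (2 * σ z - 4 * angDeriv φ z)) +
      radDeriv (fun z => σ z * (2 * σ z - 4 * angDeriv φ z)) z :=
    (continuous_const.mul hg.continuous).add (contDiff_radDeriv hg).continuous
  have i3 := integrableOn_ball cg
  have i4 := integrableOn_ball (contDiff_angDeriv hh).continuous
  have j1 := Integrable.fun_add i1 i2
  rw [← add_zero (_ + _), ← hrad, ← add_zero (_ + _), ← hang,
    ← MeasureTheory.integral_const_mul, ← MeasureTheory.integral_add i1 i2,
    ← MeasureTheory.integral_add j1 i3, ← MeasureTheory.integral_add (Integrable.fun_add j1 i3) i4]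
  refine setIntegral_congr_fun measurableSet_ball fun z _ => ?_
  have dσ : Differentiable ℝ σ := hσ.differentiable (by simp)
  have dr : Differentiable ℝ (radDeriv φ) := pr.differentiable (by simp)
  have da : Differentiable ℝ (angDeriv φ) := pa.differentiable (by simp)
  have e1 : radDeriv (fun z => 2 * σ z - 4 * angDeriv φ z) z =
      2 * radDeriv σ z - 4 * radDeriv (angDeriv φ) z := by
    simp only [radDeriv]
    rw [fderiv_fun_sub ((dσ z).const_mul 2) ((da z).const_mul 4), fderiv_const_mul (dσ z),
      fderiv_const_mul (da z)]
    simp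
  have e2 : angDeriv (fun z => 4 * radDeriv φ z) z = 4 * angDeriv (radDeriv φ) z := by
    rw [angDeriv, fderiv_const_mul (dr z)]
    simp [angDeriv]
  simp only [secondOrder]
  rw [radDeriv_mul dσ ((dσ.const_mul 2).fun_sub (da.const_mul 4)), angDeriv_mul dσ (dr.const_mul 4),
    e1, e2, radDeriv_angDeriv_comm hφ]
  ring

/-- for smooth σ, φ, ψ, η with σ = 0 on ∂D, the second derivative at t = 0
of the ∂̄-energy of the family F_t equals
∫_D (rφ_r − σ_θ)² + (rσ_r + φ_θ)² (r dr dθ) + ∫_D 4(ψ_x + η_y)² + 4(η_x − ψ_y)² dx dy,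
and in particular is nonnegative: f₄ is stable along these variations. -/
theorem stmt19 (σ φ ψ η : ℂ → ℝ)
    (hσ : ContDiff ℝ (⊤ : ℕ∞) σ) (hφ : ContDiff ℝ (⊤ : ℕ∞) φ) (hψ : ContDiff ℝ (⊤ : ℕ∞) ψ) (hη : ContDiff ℝ (⊤ : ℕ∞) η)
    (hσ0 : ∀ z ∈ Metric.sphere (0:ℂ) 1, σ z = 0) :
    deriv (deriv (Gfam σ φ ψ η)) 0 =
      (∫ θ in (0:ℝ)..(2*Real.pi), ∫ r in (0:ℝ)..1,
        r * ((r * pdr φ r θ - pdθ σ r θ)^2 + (r * pdr σ r θ + pdθ φ r θ)^2)) +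
      (∫ z in Metric.ball (0:ℂ) 1,
        (4 * (fderiv ℝ ψ z 1 + fderiv ℝ η z Complex.I)^2 +
         4 * (fderiv ℝ η z 1 - fderiv ℝ ψ z Complex.I)^2)) ∧
    0 ≤ deriv (deriv (Gfam σ φ ψ η)) 0 := by
  have hpolar : (∫ θ in (0:ℝ)..(2*Real.pi), ∫ r in (0:ℝ)..1,
      r * ((r * pdr φ r θ - pdθ σ r θ)^2 + (r * pdr σ r θ + pdθ φ r θ)^2)) =
      ∫ z in Metric.ball (0:ℂ) 1,
        ((radDeriv φ z - angDeriv σ z) ^ 2 + (radDeriv σ z + angDeriv φ z) ^ 2) := by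
    have c2 := (contDiff_radDeriv hσ).continuous
    have c3 := (contDiff_angDeriv hσ).continuous
    have c4 := (contDiff_radDeriv hφ).continuous
    have c5 := (contDiff_angDeriv hφ).continuous
    have dσ : Differentiable ℝ σ := hσ.differentiable (by simp)
    have dφ : Differentiable ℝ φ := hφ.differentiable (by simp)
    rw [integral_ball_eq_integral_pol' (by fun_prop)]
    simp only [mul_pdr dσ, mul_pdr dφ, pdθ_eq dσ, pdθ_eq dφ]
  have heq := (deriv_deriv_Gfam hσ hφ hψ hη).trans
    (two_mul_integral_secondOrder hσ hφ hψ hη hσ0)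
  rw [hpolar]
  refine ⟨heq, ?_⟩
  rw [heq]
  exact add_nonneg (integral_nonneg fun z => by positivity) (integral_nonneg fun z => by positivity)
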